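/- Let k be a commutative ring and define, for a filtered object X(⋆) ∈ DF(k) = Fun(ℤᵒᵖ, D(k)), the subcategories DF(k)_{≥0} = {X : gr^n X ∈ D(k)_{≥ -n} for all n} and DF(k)_{≤0} = {X : X(n) ∈ D(k)_{≤ -n} for all n}. Then the pair (DF(k)_{≥0}, DF(k)_{≤0}) satisfies the axioms of a t-structure on DF(k): (i) Hom(X, Y[-1]) = 0 for X ∈ DF(k)_{≥0}, Y ∈ DF(k)_{≤0}; (ii) DF(k)_{≥0}[1] ⊆ DF(k)_{≥0} and DF(k)_{≤0}[-1] ⊆ DF(k)_{≤0}; (iii) every X fits in a fiber sequence X' → X → X'' with X' ∈ DF(k)_{≥0} and X'' ∈ DF(k)_{≤0}[-1]. -/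

import Mathlib

open CategoryTheory Limits Opposite Pretriangulated

variable (k : Type*) [CommRing k] [HasDerivedCategory (ModuleCat k)]

/-- the `i`-th (homological) homology of an object of `D(k)`: `H_i = H^{-i}`. -/
noncomputable def Hh (i : ℤ) (G : DerivedCategory (ModuleCat k)) : ModuleCat k :=
  (DerivedCategory.homologyFunctor (ModuleCat k) (-i)).obj G

/-- `G` is the `n`-th graded piece of the filtered object `X ∈ DF(k) = Fun(ℤᵒᵖ, D(k))`,
i.e. a cone of the transition map `X(n+1) → X(n)`. -/
def IsGradedPiece (X : ℤᵒᵖ ⥤ DerivedCategory (ModuleCat k)) (n : ℤ)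
    (G : DerivedCategory (ModuleCat k)) : Prop :=
  ∃ (g : X.obj (op n) ⟶ G) (h : G ⟶ (X.obj (op (n + 1)))⟦(1 : ℤ)⟧),
    Triangle.mk (X.map (homOfLE (by omega : n ≤ n + 1)).op) g h ∈
      distTriang (DerivedCategory (ModuleCat k))

/-- `X ∈ DF(k)_{≥0}` for the Beilinson t-structure: `gr^n X ∈ D(k)_{≥ -n}` for all `n`. -/
def BConnective (X : ℤᵒᵖ ⥤ DerivedCategory (ModuleCat k)) : Prop :=
  ∀ (n : ℤ) (G : DerivedCategory (ModuleCat k)), IsGradedPiece k X n G →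
    ∀ i : ℤ, i < -n → IsZero (Hh k i G)

/-- `X ∈ DF(k)_{≤0}` for the Beilinson t-structure: `X(n) ∈ D(k)_{≤ -n}` for all `n`. -/
def BCoconnective (X : ℤᵒᵖ ⥤ DerivedCategory (ModuleCat k)) : Prop :=
  ∀ n i : ℤ, -n < i → IsZero (Hh k i (X.obj (op n)))

universe w v u

namespace BeilinsonTStructure

open DerivedCategory

variable {R : Type u} [CommRing R]

/-- The elementwise condition expressing that the mapping cone of `f : K ⟶ L` is exact in
degree `i + 1`. -/
def ConeExact {K L : CochainComplex (ModuleCat.{v} R) ℤ} (f : K ⟶ L) (i : ℤ) : Prop :=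
  ∀ (x : L.X (i + 1)) (z : K.X (i + 1 + 1)), K.d (i + 1 + 1) (i + 1 + 1 + 1) z = 0 →
    f.f (i + 1 + 1) z = L.d (i + 1) (i + 1 + 1) x →
    ∃ (v : K.X (i + 1)) (u : L.X i),
      K.d (i + 1) (i + 1 + 1) v = z ∧ x = f.f (i + 1) v + L.d i (i + 1) u

lemma exactAt_succ_iff (K : CochainComplex (ModuleCat.{v} R) ℤ) (i : ℤ) :
    K.ExactAt (i + 1) ↔
      ∀ x : K.X (i + 1), K.d (i + 1) (i + 1 + 1) x = 0 → ∃ y : K.X i, K.d i (i + 1) y = x := by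
  rw [K.exactAt_iff' i (i + 1) (i + 1 + 1) (by simp) (by simp), ShortComplex.moduleCat_exact_iff]
  rfl

section

variable {K L : CochainComplex (ModuleCat.{v} R) ℤ} (f : K ⟶ L)

lemma exactAt_mappingCone_iff (i : ℤ) :
    (CochainComplex.mappingCone f).ExactAt (i + 1) ↔ ConeExact f i := by
  rw [exactAt_succ_iff]
  have id_X (p : ℤ) (x : (CochainComplex.mappingCone f).X p) :
      x = (CochainComplex.mappingCone.inl f).v (p + 1) p (by lia)
          ((CochainComplex.mappingCone.fst f).1.v p (p + 1) rfl x) +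
        (CochainComplex.mappingCone.inr f).f p
          ((CochainComplex.mappingCone.snd f).v p p (add_zero p) x) := by
    have := ConcreteCategory.congr_hom (CochainComplex.mappingCone.id_X f p (p + 1) rfl) x
    simpa using this.symm
  have hfst (p : ℤ) (x : (CochainComplex.mappingCone f).X p) :
      (CochainComplex.mappingCone.fst f).1.v (p + 1) (p + 1 + 1) rfl
        ((CochainComplex.mappingCone f).d p (p + 1) x) =
      - K.d (p + 1) (p + 1 + 1) ((CochainComplex.mappingCone.fst f).1.v p (p + 1) rfl x) := by
    have := ConcreteCategory.congr_hom
      (CochainComplex.mappingCone.d_fst_v f p (p + 1) (p + 1 + 1) rfl rfl) x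
    simpa using this
  have hsnd (p : ℤ) (x : (CochainComplex.mappingCone f).X p) :
      (CochainComplex.mappingCone.snd f).v (p + 1) (p + 1) (add_zero _)
        ((CochainComplex.mappingCone f).d p (p + 1) x) =
      f.f (p + 1) ((CochainComplex.mappingCone.fst f).1.v p (p + 1) rfl x) +
        L.d p (p + 1) ((CochainComplex.mappingCone.snd f).v p p (add_zero p) x) := by
    have := ConcreteCategory.congr_hom (CochainComplex.mappingCone.d_snd_v f p (p + 1) rfl) x
    simpa using this
  have mk (p : ℤ) (a : K.X (p + 1)) (b : L.X p) : ∃ x : (CochainComplex.mappingCone f).X p,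
      (CochainComplex.mappingCone.fst f).1.v p (p + 1) rfl x = a ∧
      (CochainComplex.mappingCone.snd f).v p p (add_zero p) x = b := by
    refine ⟨(CochainComplex.mappingCone.inl f).v (p + 1) p (by lia) a +
      (CochainComplex.mappingCone.inr f).f p b, ?_, ?_⟩
    · rw [map_add]
      exact (congrArg₂ (· + ·)
        (ConcreteCategory.congr_hom (CochainComplex.mappingCone.inl_v_fst_v f (p + 1) p rfl) a)
        (ConcreteCategory.congr_hom (CochainComplex.mappingCone.inr_f_fst_v f p (p + 1) rfl) b)).trans
        (add_zero a)
    · rw [map_add]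
      exact (congrArg₂ (· + ·)
        (ConcreteCategory.congr_hom
          (CochainComplex.mappingCone.inl_v_snd_v f (p + 1) p (by lia)) a)
        (ConcreteCategory.congr_hom (CochainComplex.mappingCone.inr_f_snd_v f p) b)).trans
        (zero_add b)
  have ext (p : ℤ) (x y : (CochainComplex.mappingCone f).X p)
      (h1 : (CochainComplex.mappingCone.fst f).1.v p (p + 1) rfl x =
        (CochainComplex.mappingCone.fst f).1.v p (p + 1) rfl y)
      (h2 : (CochainComplex.mappingCone.snd f).v p p (add_zero p) x =
        (CochainComplex.mappingCone.snd f).v p p (add_zero p) y) : x = y := by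
    rw [id_X p x, id_X p y, h1, h2]
  constructor
  · intro h x z hz hx
    obtain ⟨a, ha1, ha2⟩ := mk (i + 1) (-z) x
    obtain ⟨b, hb⟩ := h a (ext _ _ _ (by rw [hfst, ha1]; simp [hz])
      (by rw [hsnd, ha1, ha2]; simp [hx]))
    refine ⟨(CochainComplex.mappingCone.fst f).1.v i (i + 1) rfl b,
      (CochainComplex.mappingCone.snd f).v i i (add_zero i) b, ?_, ?_⟩
    · rw [← neg_inj, ← hfst, hb, ha1]
    · rw [← hsnd, hb, ha2]
  · intro h a ha
    have h1 := hfst _ a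
    have h2 := hsnd _ a
    rw [ha, map_zero] at h1 h2
    obtain ⟨v, u, hv, hu⟩ := h ((CochainComplex.mappingCone.snd f).v _ _ (add_zero _) a)
      (-(CochainComplex.mappingCone.fst f).1.v _ _ rfl a)
      (by rw [map_neg]; exact h1.symm)
      (by rw [map_neg, neg_eq_iff_add_eq_zero]; exact h2.symm)
    obtain ⟨b, hb1, hb2⟩ := mk i v u
    refine ⟨b, ext _ _ _ ?_ ?_⟩
    · rw [hfst, hb1, hv, neg_neg]
    · rw [hsnd, hb1, hb2, hu]

variable [HasDerivedCategory.{w} (ModuleCat.{v} R)]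

lemma isZero_homology_Q_obj_iff (K : CochainComplex (ModuleCat.{v} R) ℤ) (i : ℤ) :
    IsZero ((homologyFunctor (ModuleCat.{v} R) i).obj (Q.obj K)) ↔ K.ExactAt i := by
  rw [HomologicalComplex.exactAt_iff_isZero_homology]
  exact ((homologyFunctorFactors (ModuleCat.{v} R) i).app K).isZero_iff

/-- The standard distinguished triangle on a morphism of complexes. -/
noncomputable abbrev coneTriangle : Triangle (DerivedCategory (ModuleCat.{v} R)) :=
  Q.mapTriangle.obj (CochainComplex.mappingCone.triangle f)

lemma coneTriangle_distinguished : coneTriangle f ∈ distTriang _ := by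
  rw [mem_distTriang_iff]
  exact ⟨_, _, f, ⟨Iso.refl _⟩⟩

lemma isIso_Q_map_iff : IsIso (Q.map f) ↔ ∀ i, ConeExact f i := by
  have h1 : IsIso (Q.map f) ↔ IsZero (Q.obj (CochainComplex.mappingCone f)) :=
    (Triangle.isZero₃_iff_isIso₁ _ (coneTriangle_distinguished f)).symm
  have h2 : IsZero (Q.obj (CochainComplex.mappingCone f)) ↔
      (CochainComplex.mappingCone f).Acyclic :=
    ⟨fun h i => (isZero_homology_Q_obj_iff _ i).1 ((homologyFunctor _ i).map_isZero h),
      fun h => by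
        have : IsIso (0 : Q.obj (CochainComplex.mappingCone f) ⟶
            Q.obj (CochainComplex.mappingCone f)) := by
          rw [DerivedCategory.isIso_iff]
          intro i
          have h1 := (isZero_homology_Q_obj_iff (CochainComplex.mappingCone f) i).2 (h i)
          exact ⟨0, h1.eq_of_src _ _, h1.eq_of_src _ _⟩
        exact (IsZero.iff_id_eq_zero _).2 ((cancel_mono
          (0 : Q.obj (CochainComplex.mappingCone f) ⟶
            Q.obj (CochainComplex.mappingCone f))).1 (by simp))⟩
  rw [h1, h2]
  refine ⟨fun h i => (exactAt_mappingCone_iff f i).1 (h _), fun h i => ?_⟩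
  obtain ⟨j, rfl⟩ : ∃ j, i = j + 1 := ⟨i - 1, by lia⟩
  exact (exactAt_mappingCone_iff f j).2 (h j)

/-- The third object of a distinguished triangle on `Q.map f`, up to isomorphisms. -/
lemma isZero_homology_obj₃ (T : Triangle (DerivedCategory (ModuleCat.{v} R)))
    (hT : T ∈ distTriang _) (e : Arrow.mk (Q.map f) ≅ Arrow.mk T.mor₁) (i : ℤ)
    (hf : ConeExact f i) :
    IsZero ((homologyFunctor (ModuleCat.{v} R) (i + 1)).obj T.obj₃) := by
  have := isoTriangleOfIso₁₂ _ _ (coneTriangle_distinguished f) hT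
    (Arrow.leftFunc.mapIso e) (Arrow.rightFunc.mapIso e) e.hom.w.symm
  exact ((isZero_homology_Q_obj_iff _ _).2 ((exactAt_mappingCone_iff f i).2 hf)).of_iso
    ((homologyFunctor _ _).mapIso (Triangle.π₃.mapIso this).symm)

end

section Subcomplex

/-- A subcomplex of a complex of modules. -/
@[ext]
structure Subcomplex (A : CochainComplex (ModuleCat.{v} R) ℤ) where
  /-- the submodule in each degree -/
  carrier (i : ℤ) : Submodule R (A.X i)
  d_mem (i j : ℤ) (x : A.X i) (hx : x ∈ carrier i) : A.d i j x ∈ carrier j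

namespace Subcomplex

variable {A : CochainComplex (ModuleCat.{v} R) ℤ}

instance : PartialOrder (Subcomplex A) :=
  PartialOrder.lift carrier (fun _ _ h => Subcomplex.ext h)

/-- A subcomplex as a complex. -/
noncomputable def toComplex (S : Subcomplex A) : CochainComplex (ModuleCat.{v} R) ℤ where
  X i := ModuleCat.of R (S.carrier i)
  d i j := ModuleCat.ofHom ((A.d i j).hom.restrict (S.d_mem i j))
  shape i j h := by
    ext x
    exact ConcreteCategory.congr_hom (A.shape i j h) x.1
  d_comp_d' i j k _ _ := by
    ext x
    exact ConcreteCategory.congr_hom (A.d_comp_d i j k) x.1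

/-- The inclusion between subcomplexes. -/
noncomputable def ofLE {S T : Subcomplex A} (h : S ≤ T) : S.toComplex ⟶ T.toComplex where
  f i := ModuleCat.ofHom (Submodule.inclusion (h i))
  comm' i j _ := by
    ext x
    rfl

/-- Morphisms to a subcomplex, given elementwise. -/
noncomputable def lift {K : CochainComplex (ModuleCat.{v} R) ℤ} (S : Subcomplex A) (f : K ⟶ A)
    (hf : ∀ i x, f.f i x ∈ S.carrier i) : K ⟶ S.toComplex where
  f i := ModuleCat.ofHom ((f.f i).hom.codRestrict (S.carrier i) (hf i))
  comm' i j _ := by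
    ext x
    exact Subtype.ext (ConcreteCategory.congr_hom (f.comm i j) x)

lemma coneExact_ofLE {S T : Subcomplex A} (h : S ≤ T) (i : ℤ)
    (H : ∀ x ∈ T.carrier (i + 1), A.d (i + 1) (i + 1 + 1) x ∈ S.carrier (i + 1 + 1) →
      ∃ u ∈ T.carrier i, x - A.d i (i + 1) u ∈ S.carrier (i + 1)) :
    ConeExact (ofLE h) i := by
  intro x z hz hx
  have hx' : z.1 = A.d (i + 1) (i + 1 + 1) x.1 := congrArg Subtype.val hx
  obtain ⟨u, hu, hxu⟩ := H x.1 x.2 (hx' ▸ z.2)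
  refine ⟨⟨x.1 - A.d i (i + 1) u, hxu⟩, ⟨u, hu⟩, Subtype.ext ?_, Subtype.ext ?_⟩
  · change A.d _ _ (x.1 - A.d i (i + 1) u) = z.1
    rw [map_sub, hx']
    have : A.d (i + 1) (i + 1 + 1) (A.d i (i + 1) u) = 0 :=
      ConcreteCategory.congr_hom (A.d_comp_d i (i + 1) (i + 1 + 1)) u
    rw [this, sub_zero]
  · change x.1 = x.1 - A.d i (i + 1) u + A.d i (i + 1) u
    rw [sub_add_cancel]

/-- The functor attached to a decreasing filtration by subcomplexes. -/
noncomputable def functor {F : ℤ → Subcomplex A} (hF : Antitone F) :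
    ℤᵒᵖ ⥤ CochainComplex (ModuleCat.{v} R) ℤ where
  obj n := (F n.unop).toComplex
  map f := ofLE (hF (leOfHom f.unop))

end Subcomplex

end Subcomplex

section

variable {K L : CochainComplex (ModuleCat.{v} R) ℤ}

/-- Constructor for homotopies between morphisms of cochain complexes. -/
noncomputable def homotopyMk (f g : K ⟶ L) (H : ∀ i, K.X (i + 1) ⟶ L.X i)
    (h : ∀ i, f.f (i + 1) = K.d (i + 1) (i + 1 + 1) ≫ H (i + 1) + H i ≫ L.d i (i + 1) +
      g.f (i + 1)) : Homotopy f g where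
  hom i j := if h : i = j + 1 then (K.XIsoOfEq h).hom ≫ H j else 0
  zero i j hij := by
    rw [dif_neg]
    rintro rfl
    exact hij rfl
  comm i := by
    obtain ⟨i, rfl⟩ : ∃ j, i = j + 1 := ⟨i - 1, by lia⟩
    rw [dNext_eq _ (show (ComplexShape.up ℤ).Rel (i + 1) (i + 1 + 1) from rfl),
      prevD_eq _ (show (ComplexShape.up ℤ).Rel i (i + 1) from rfl), h]
    simp

/-- A natural transformation between functors on `ℤᵒᵖ`, from successive naturality. -/
def natTransMk {C : Type*} [Category* C] {F G : ℤᵒᵖ ⥤ C} (e : ∀ n, F.obj (op n) ⟶ G.obj (op n))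
    (he : ∀ n : ℤ, F.map (homOfLE (by lia : n ≤ n + 1)).op ≫ e n =
      e (n + 1) ≫ G.map (homOfLE (by lia : n ≤ n + 1)).op) : F ⟶ G where
  app n := e n.unop
  naturality := by
    have key (n : ℤ) (r : ℕ) : F.map (homOfLE (by lia : n ≤ n + r)).op ≫ e n =
        e (n + r) ≫ G.map (homOfLE (by lia : n ≤ n + r)).op := by
      induction r with
      | zero =>
        have (m : ℤ) (hm : n = m) : F.map (homOfLE hm.le).op ≫ e n =
            e m ≫ G.map (homOfLE hm.le).op := by
          subst hm
          change F.map (𝟙 _) ≫ _ = _ ≫ G.map (𝟙 _)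
          simp
        exact this _ (by simp)
      | succ r hr =>
        have (m : ℤ) (hm : n + r + 1 = m) : F.map (homOfLE (by lia : n ≤ m)).op ≫ e n =
            e m ≫ G.map (homOfLE (by lia : n ≤ m)).op := by
          subst hm
          have h1 : (homOfLE (by lia : n ≤ n + r + 1)).op =
            (homOfLE (by lia : n + r ≤ n + r + 1)).op ≫ (homOfLE (by lia : n ≤ n + r)).op := rfl
          rw [h1, F.map_comp, G.map_comp, Category.assoc, hr, ← Category.assoc, he,
            Category.assoc]
        exact this _ (by push_cast; ring)
    intro m n f
    obtain ⟨r, hr⟩ := Int.le.dest (leOfHom f.unop)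
    obtain ⟨m⟩ := m
    obtain ⟨n⟩ := n
    change n + r = m at hr
    subst hr
    exact key n r

end

section Telescope

variable {C Y : ℤ → CochainComplex (ModuleCat.{v} R) ℤ} (s : ∀ n, Y n ⟶ C n)
  (g : ∀ n, Y (n + 1) ⟶ C n)

/-- The differential of the complex `telescope s g`. -/
def telescopeD (i : ℤ) :
    ((∀ m, (C m).X i) × (∀ m, (Y m).X (i + 1))) →ₗ[R]
      ((∀ m, (C m).X (i + 1)) × (∀ m, (Y m).X (i + 1 + 1))) where
  toFun x := (fun m => (C m).d i (i + 1) (x.1 m) + (s m).f (i + 1) (x.2 m) -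
    (g m).f (i + 1) (x.2 (m + 1)), fun m => - (Y m).d (i + 1) (i + 1 + 1) (x.2 m))
  map_add' x y := by
    ext m
    · simp only [Prod.fst_add, Prod.snd_add, Pi.add_apply, map_add]
      abel
    · simp only [Prod.snd_add, Pi.add_apply, map_add]
      abel
  map_smul' r x := by
    ext m
    · simp [smul_sub]
    · simp

lemma telescopeD_telescopeD (i : ℤ) (x : (∀ m, (C m).X i) × (∀ m, (Y m).X (i + 1))) :
    telescopeD s g (i + 1) (telescopeD s g i x) = 0 := by
  ext m
  · have h1 := ConcreteCategory.congr_hom ((C m).d_comp_d i (i + 1) (i + 1 + 1)) (x.1 m)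
    have h2 := ConcreteCategory.congr_hom ((s m).comm (i + 1) (i + 1 + 1)) (x.2 m)
    have h3 := ConcreteCategory.congr_hom ((g m).comm (i + 1) (i + 1 + 1)) (x.2 (m + 1))
    simp only [ConcreteCategory.comp_apply] at h1 h2 h3
    simp only [telescopeD, LinearMap.coe_mk, AddHom.coe_mk, map_sub, map_add, map_neg, h1, h2,
      h3, Prod.fst_zero, Pi.zero_apply]
    rw [show (0 : (C m).X i ⟶ (C m).X (i + 1 + 1)) (x.1 m) = 0 from rfl]
    abel
  · have h1 := ConcreteCategory.congr_hom
      ((Y m).d_comp_d (i + 1) (i + 1 + 1) (i + 1 + 1 + 1)) (x.2 m)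
    simp only [ConcreteCategory.comp_apply] at h1
    simp [telescopeD, h1]

/-- The product over all `m : ℤ` of the complexes `C m` and `(Y m)⟦1⟧`, with the differential
twisted by `s` and `g`. -/
noncomputable def telescope : CochainComplex (ModuleCat.{v} R) ℤ :=
  CochainComplex.of (fun i => ModuleCat.of R ((∀ m, (C m).X i) × (∀ m, (Y m).X (i + 1))))
    (fun i => ModuleCat.ofHom (telescopeD s g i)) (fun i => by
      apply ModuleCat.hom_ext
      apply LinearMap.ext
      exact telescopeD_telescopeD s g i)

lemma telescope_d_apply (i : ℤ) (x : (∀ m, (C m).X i) × (∀ m, (Y m).X (i + 1))) :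
    (telescope s g).d i (i + 1) x = telescopeD s g i x :=
  ConcreteCategory.congr_hom (CochainComplex.of_d
    (fun i => ModuleCat.of R ((∀ m, (C m).X i) × (∀ m, (Y m).X (i + 1)))) _ i) x

variable (C Y) in
/-- The submodule of families with bounded above support, which are supported in
degrees `≥ n`. -/
def telescopeSub (n i : ℤ) : Submodule R ((∀ m, (C m).X i) × (∀ m, (Y m).X (i + 1))) where
  carrier := {x | (∃ M, ∀ m > M, x.1 m = 0 ∧ x.2 m = 0) ∧ (∀ m < n, x.1 m = 0) ∧
    (∀ m ≤ n, x.2 m = 0)}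
  add_mem' := by
    rintro x y ⟨⟨M, hM⟩, h1, h2⟩ ⟨⟨M', hM'⟩, h1', h2'⟩
    refine ⟨⟨max M M', fun m hm => ?_⟩, fun m hm => ?_, fun m hm => ?_⟩
    · have a := hM m (by lia)
      have b := hM' m (by lia)
      exact ⟨by simp [a, b], by simp [a, b]⟩
    · simp [h1 m hm, h1' m hm]
    · simp [h2 m hm, h2' m hm]
  zero_mem' := ⟨⟨0, fun _ _ => ⟨rfl, rfl⟩⟩, fun _ _ => rfl, fun _ _ => rfl⟩
  smul_mem' := by
    rintro r x ⟨⟨M, hM⟩, h1, h2⟩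
    refine ⟨⟨M, fun m hm => ?_⟩, fun m hm => ?_, fun m hm => ?_⟩
    · exact ⟨by simp [hM m hm], by simp [hM m hm]⟩
    · simp [h1 m hm]
    · simp [h2 m hm]

lemma telescopeD_mem (n i : ℤ) {x : (∀ m, (C m).X i) × (∀ m, (Y m).X (i + 1))}
    (hx : x ∈ telescopeSub C Y n i) : telescopeD s g i x ∈ telescopeSub C Y n (i + 1) := by
  obtain ⟨⟨M, hM⟩, h1, h2⟩ := hx
  refine ⟨⟨M, fun m hm => ?_⟩, fun m hm => ?_, fun m hm => ?_⟩
  · have a := hM m hm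
    have b := hM (m + 1) (by lia)
    exact ⟨by simp [telescopeD, a, b], by simp [telescopeD, a]⟩
  · simp [telescopeD, h1 m hm, h2 m hm.le, h2 (m + 1) (by lia)]
  · simp [telescopeD, h2 m hm]

/-- The decreasing filtration on the telescope: families with bounded above support, which are
supported in degrees `≥ n`. -/
noncomputable def telescopeFil (n : ℤ) : Subcomplex (telescope s g) where
  carrier i := telescopeSub C Y n i
  d_mem i j x hx := by
    by_cases hij : i + 1 = j
    · subst hij
      exact (telescope_d_apply s g i x).symm ▸ telescopeD_mem s g n i hx
    · rw [(telescope s g).shape i j hij]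
      exact zero_mem _

lemma antitone_telescopeFil : Antitone (telescopeFil s g) := by
  rintro n n' h i x ⟨h0, h1, h2⟩
  exact ⟨h0, fun m hm => h1 m (by lia), fun m hm => h2 m (by lia)⟩

variable (Y) in
lemma single_zero_mem (n i : ℤ) (c : (C n).X i) : (Pi.single n c, 0) ∈ telescopeSub C Y n i :=
  ⟨⟨n, fun m hm => ⟨by simp [Pi.single_eq_of_ne (show m ≠ n by lia)], rfl⟩⟩,
    fun m hm => by simp [Pi.single_eq_of_ne (show m ≠ n by lia)], fun _ _ => rfl⟩

variable (C) in
lemma zero_single_mem (n m i : ℤ) (h : n < m) (y : (Y m).X (i + 1)) :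
    (0, Pi.single m y) ∈ telescopeSub C Y n i :=
  ⟨⟨m, fun m' hm => ⟨rfl, by simp [Pi.single_eq_of_ne (show m' ≠ m by lia)]⟩⟩,
    fun _ _ => rfl, fun m' hm => by simp [Pi.single_eq_of_ne (show m' ≠ m by lia)]⟩

lemma telescopeD_single_zero (n i : ℤ) (c : (C n).X i) :
    telescopeD s g i (Pi.single n c, 0) = (Pi.single n ((C n).d i (i + 1) c), 0) := by
  ext m
  · by_cases h : m = n
    · subst h
      simp [telescopeD]
    · simp [telescopeD, Pi.single_eq_of_ne h]
  · simp [telescopeD]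

lemma telescopeD_zero_single (n i : ℤ) (y : (Y (n + 1)).X (i + 1)) :
    telescopeD s g i (0, Pi.single (n + 1) y) =
      (Pi.single (n + 1) ((s (n + 1)).f (i + 1) y) - Pi.single n ((g n).f (i + 1) y),
        Pi.single (n + 1) (- (Y (n + 1)).d (i + 1) (i + 1 + 1) y)) := by
  ext m
  · by_cases h : m = n + 1
    · subst h
      simp [telescopeD]
    · by_cases h' : m = n
      · subst h'
        simp [telescopeD]
      · simp [telescopeD, Pi.single_eq_of_ne h, Pi.single_eq_of_ne h',
          Pi.single_eq_of_ne (show m + 1 ≠ n + 1 by lia)]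
  · by_cases h : m = n + 1
    · subst h
      simp [telescopeD]
    · simp [telescopeD, Pi.single_eq_of_ne h]

/-- The inclusion of `C n` in the telescope. -/
noncomputable def telescopeSingle (n : ℤ) : C n ⟶ telescope s g where
  f i := ModuleCat.ofHom
    (LinearMap.inl R (∀ m, (C m).X i) (∀ m, (Y m).X (i + 1)) ∘ₗ
      LinearMap.single R (fun m => (C m).X i) n)
  comm' i j hij := by
    obtain rfl : i + 1 = j := hij
    ext c
    exact (telescope_d_apply s g i _).trans (telescopeD_single_zero s g n i c)

/-- The inclusion of `C n` in the `n`-th step of the filtration on the telescope. -/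
noncomputable def telescopeι (n : ℤ) : C n ⟶ (telescopeFil s g n).toComplex :=
  (telescopeFil s g n).lift (telescopeSingle s g n) (fun i c => single_zero_mem Y n i c)

/-- The two maps from `Y (n + 1)` to the `n`-th step of the filtration on the telescope
are homotopic. -/
noncomputable def telescopeHomotopy (n : ℤ) :
    Homotopy (s (n + 1) ≫ telescopeι s g (n + 1) ≫
      Subcomplex.ofLE (antitone_telescopeFil s g (by lia : n ≤ n + 1)))
      (g n ≫ telescopeι s g n) :=
  homotopyMk _ _ (fun i => ModuleCat.ofHom (LinearMap.codRestrict (telescopeSub C Y n i)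
    (LinearMap.inr R (∀ m, (C m).X i) (∀ m, (Y m).X (i + 1)) ∘ₗ
      LinearMap.single R (fun m => (Y m).X (i + 1)) (n + 1))
      (fun y => zero_single_mem C n (n + 1) i (by lia) y))) (fun i => by
    ext y
    apply Subtype.ext
    have h := (telescope_d_apply s g i (0, Pi.single (n + 1) y)).trans
      (telescopeD_zero_single s g n i y)
    refine Eq.trans ?_ (congrArg (fun t => (((0, Pi.single (n + 1) ((Y (n + 1)).d _ _ y)) :
      (∀ m, (C m).X (i + 1)) × (∀ m, (Y m).X (i + 1 + 1))) + t) +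
        ((Pi.single n ((g n).f (i + 1) y), 0) :
          (∀ m, (C m).X (i + 1)) × (∀ m, (Y m).X (i + 1 + 1)))) h).symm
    change ((Pi.single (n + 1) ((s (n + 1)).f (i + 1) y), 0) :
      (∀ m, (C m).X (i + 1)) × (∀ m, (Y m).X (i + 1 + 1))) = _
    ext1
    · simp
    · simp [Pi.single_neg])

lemma coneExact_telescopeι (n : ℤ) (hs : ∀ n i, ConeExact (s n) i) (i : ℤ) :
    ConeExact (telescopeι s g n) i := by
  have key (r : ℕ) : ∀ x ∈ telescopeSub C Y n (i + 1),
      (∀ m > n + r, x.1 m = 0 ∧ x.2 m = 0) →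
      (∀ m ≠ n, (telescopeD s g (i + 1) x).1 m = 0) →
      (∀ m, (telescopeD s g (i + 1) x).2 m = 0) →
      ∃ (v : (C n).X (i + 1)), ∃ u ∈ telescopeSub C Y n i,
        x = (Pi.single n v, 0) + telescopeD s g i u := by
    induction r with
    | zero =>
      rintro x ⟨-, h1, h2⟩ hx - -
      refine ⟨x.1 n, 0, zero_mem _, ?_⟩
      ext m
      · by_cases h : m = n
        · subst h
          simp
        · obtain h | h : m < n ∨ n + ((0 : ℕ) : ℤ) < m := by
            push_cast
            lia
          · simp [Pi.single_eq_of_ne h.ne, h1 _ h]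
          · simp [Pi.single_eq_of_ne (show m ≠ n by lia), (hx _ h).1]
      · obtain h | h : m ≤ n ∨ n + ((0 : ℕ) : ℤ) < m := by
          push_cast
          lia
        · simp [h2 _ h]
        · simp [(hx _ h).2]
    | succ r hr =>
      intro x hx h0 h1 h2
      obtain ⟨M, hM⟩ : ∃ M, M + 1 = n + ((r + 1 : ℕ) : ℤ) := ⟨n + r, by push_cast; ring⟩
      push_cast at hM
      have e1 := h1 (M + 1) (by lia)
      have e2 := h2 (M + 1)
      simp only [telescopeD, LinearMap.coe_mk, AddHom.coe_mk, neg_eq_zero,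
        (h0 (M + 1 + 1) (by push_cast; lia)).2, map_zero, sub_zero] at e1 e2
      obtain ⟨v, u, hv, hu⟩ := hs (M + 1) i (x.1 (M + 1)) (- x.2 (M + 1)) (by simp [e2])
        (by rw [map_neg, neg_eq_iff_add_eq_zero]; exact (add_comm _ _).trans e1)
      let w : (∀ m, (C m).X i) × (∀ m, (Y m).X (i + 1)) :=
        (Pi.single (M + 1) u, 0) + (0, Pi.single (M + 1) v)
      have hw : w ∈ telescopeSub C Y n i := by
        refine ⟨⟨M + 1, fun m hm => ?_⟩, fun m hm => ?_, fun m hm => ?_⟩ <;>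
          simp [w, Pi.single_eq_of_ne (show m ≠ M + 1 by lia)]
      have hdw : telescopeD s g i w = _ := (map_add _ _ _).trans (congrArg₂ (· + ·)
        (telescopeD_single_zero s g (M + 1) i u) (telescopeD_zero_single s g M i v))
      have hddw := telescopeD_telescopeD s g i w
      obtain ⟨v', u', hu', hx'⟩ := hr (x - telescopeD s g i w)
        (sub_mem hx (telescopeD_mem s g n i hw)) (fun m hm => by
          rw [hdw]
          by_cases h : m = M + 1
          · subst h
            simp [hu, hv, add_comm]
          · have := h0 m (by push_cast; lia)
            simp [Pi.single_eq_of_ne h, Pi.single_eq_of_ne (show m ≠ M by lia), this])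
        (by rw [map_sub, hddw, sub_zero]; exact h1)
        (by rw [map_sub, hddw, sub_zero]; exact h2)
      refine ⟨v', u' + w, add_mem hu' hw, ?_⟩
      rw [map_add, ← add_assoc, ← hx', sub_add_cancel]
  rintro ⟨x, hx⟩ z hz h
  have h' : ((Pi.single n z, 0) : (∀ m, (C m).X (i + 1 + 1)) × (∀ m, (Y m).X (i + 1 + 1 + 1))) =
      telescopeD s g (i + 1) x :=
    (congrArg Subtype.val h).trans (telescope_d_apply s g (i + 1) x)
  obtain ⟨M, hM⟩ := hx.1
  obtain ⟨v, u, hu, h1⟩ := key (M - n).toNat x hx (fun m hm => hM m (by lia))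
    (fun m hm => by rw [← h']; simp [Pi.single_eq_of_ne hm]) (fun m => by rw [← h']; rfl)
  refine ⟨v, ⟨u, hu⟩, ?_, Subtype.ext ?_⟩
  · rw [h1, map_add, telescopeD_telescopeD, telescopeD_single_zero, add_zero] at h'
    exact (Pi.single_injective n (congrArg Prod.fst h')).symm
  · exact h1.trans (congrArg (fun t => ((Pi.single n v, 0) :
      (∀ m, (C m).X (i + 1)) × (∀ m, (Y m).X (i + 1 + 1))) + t)
        (telescope_d_apply s g i u).symm)

end Telescope

section Strictification

variable [HasDerivedCategory.{w} (ModuleCat.{v} R)]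

/-- Every functor from `ℤᵒᵖ` to the derived category can be strictified to a decreasing filtration
of a complex. -/
lemma exists_strictification (X : ℤᵒᵖ ⥤ DerivedCategory (ModuleCat.{v} R)) :
    ∃ (A : CochainComplex (ModuleCat.{v} R) ℤ) (F : ℤ → Subcomplex A) (hF : Antitone F),
      Nonempty (Subcomplex.functor hF ⋙ Q ≅ X) := by
  let C (n : ℤ) : CochainComplex (ModuleCat.{v} R) ℤ := Q.objPreimage (X.obj (op n))
  let θ (n : ℤ) : Q.obj (C n) ≅ X.obj (op n) := Q.objObjPreimageIso (X.obj (op n))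
  have hfac (n : ℤ) : ∃ (Y : CochainComplex (ModuleCat.{v} R) ℤ) (s : Y ⟶ C n)
      (_ : IsIso (Q.map s)), ∀ (m : ℤ) (h : m + 1 = n), ∃ (g : Y ⟶ C m),
        Q.map s ≫ (θ n).hom ≫ X.map (homOfLE (by lia : m ≤ n)).op = Q.map g ≫ (θ m).hom := by
    obtain ⟨Y, s, hs, g, hg⟩ := right_fac ((θ n).hom ≫
      X.map (homOfLE (by lia : n - 1 ≤ n)).op ≫ (θ (n - 1)).inv)
    refine ⟨Y, s, hs, fun m h => ?_⟩
    obtain rfl : m = n - 1 := by lia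
    refine ⟨g, ?_⟩
    rw [← cancel_mono (θ (n - 1)).inv, Category.assoc, Category.assoc, Category.assoc,
      Iso.hom_inv_id, Category.comp_id, hg, IsIso.hom_inv_id_assoc]
  choose Y s hs g hg using hfac
  let g' (n : ℤ) : Y (n + 1) ⟶ C n := g (n + 1) n rfl
  have hι (n : ℤ) : IsIso (Q.map (telescopeι s g' n)) := (isIso_Q_map_iff _).2
    (coneExact_telescopeι s g' n (fun n => (isIso_Q_map_iff _).1 (hs n)))
  let e (n : ℤ) : Q.obj (telescopeFil s g' n).toComplex ≅ X.obj (op n) :=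
    (asIso (Q.map (telescopeι s g' n))).symm ≪≫ θ n
  let F := Subcomplex.functor (antitone_telescopeFil s g') ⋙ Q
  let φ : F ⟶ X := natTransMk (fun n => (e n).hom) (fun n => by
    change Q.map (Subcomplex.ofLE (antitone_telescopeFil s g' (by lia : n ≤ n + 1))) ≫ (e n).hom =
      (e (n + 1)).hom ≫ X.map (homOfLE (by lia : n ≤ n + 1)).op
    rw [← cancel_epi (Q.map (telescopeι s g' (n + 1))), ← cancel_epi (Q.map (s (n + 1)))]
    have h1 := Q_map_eq_of_homotopy _ (telescopeHomotopy s g' n)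
    rw [Q.map_comp, Q.map_comp, Q.map_comp] at h1
    have h2 := h1 =≫ (e n).hom
    simp only [Category.assoc] at h2
    refine h2.trans ?_
    simp only [e, Iso.trans_hom, Iso.symm_hom, asIso_inv, Category.assoc, IsIso.hom_inv_id_assoc]
    exact (hg (n + 1) n rfl).symm)
  have (n : ℤᵒᵖ) : IsIso (φ.app n) := (inferInstance : IsIso (e n.unop).hom)
  have := NatIso.isIso_of_isIso_app φ
  exact ⟨_, _, antitone_telescopeFil s g', ⟨asIso φ⟩⟩

end Strictification

/-- The functor sending `n` to the standard triangle on the morphism `η.app n`. -/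
noncomputable def triangleFunctor {J : Type*} [Category* J]
    {F G : J ⥤ CochainComplex (ModuleCat.{v} R) ℤ} (η : F ⟶ G) :
    J ⥤ Triangle (CochainComplex (ModuleCat.{v} R) ℤ) where
  obj n := CochainComplex.mappingCone.triangle (η.app n)
  map f := CochainComplex.mappingCone.triangleMap _ _ (F.map f) (G.map f) (η.naturality f).symm
  map_id n := by
    ext1
    · exact F.map_id n
    · exact G.map_id n
    · simp only [CochainComplex.mappingCone.triangleMap, F.map_id, G.map_id]
      exact CochainComplex.mappingCone.map_id _
  map_comp f g := by
    ext1
    · exact F.map_comp f g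
    · exact G.map_comp f g
    · simp only [CochainComplex.mappingCone.triangleMap, F.map_comp, G.map_comp]
      exact CochainComplex.mappingCone.map_comp _ _ _ _ _ (η.naturality f).symm _ _
        (η.naturality g).symm

section Truncation

variable {A : CochainComplex (ModuleCat.{v} R) ℤ} (F : ℤ → Subcomplex A)

/-- The connective cover of a filtered complex for the Beilinson t-structure: the elements
`x` of degree `i` which belong to `F (max n i)` and are such that `dx` belongs to
`F (max n (i + 1))`. -/
noncomputable def beilinsonTrunc (n : ℤ) : Subcomplex A where
  carrier i := (F (max n i)).carrier i ⊓
    ⨅ j, ((F (max n (i + 1))).carrier j).comap (A.d i j).hom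
  d_mem i j x hx := by
    by_cases hij : i + 1 = j
    · subst hij
      refine ⟨(Submodule.mem_iInf _).1 hx.2 (i + 1), (Submodule.mem_iInf _).2 fun k => ?_⟩
      have : A.d (i + 1) k (A.d i (i + 1) x) = 0 :=
        ConcreteCategory.congr_hom (A.d_comp_d i (i + 1) k) x
      exact (Submodule.mem_comap (f := (A.d (i + 1) k).hom)).2
        (this.symm ▸ zero_mem ((F (max n (i + 1 + 1))).carrier k))
    · rw [A.shape i j hij]
      exact zero_mem _

variable {F}

lemma mem_beilinsonTrunc_iff {n i : ℤ} (x : A.X i) :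
    x ∈ (beilinsonTrunc F n).carrier i ↔ x ∈ (F (max n i)).carrier i ∧
      ∀ j, A.d i j x ∈ (F (max n (i + 1))).carrier j := by
  simp [beilinsonTrunc, Submodule.mem_iInf]

variable (hF : Antitone F)
include hF

lemma antitone_beilinsonTrunc : Antitone (beilinsonTrunc F) := by
  intro n n' h i x hx
  rw [mem_beilinsonTrunc_iff] at hx ⊢
  exact ⟨hF (max_le_max_right i h) i hx.1, fun j => hF (max_le_max_right (i + 1) h) j (hx.2 j)⟩

lemma beilinsonTrunc_le (n : ℤ) : beilinsonTrunc F n ≤ F n :=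
  fun i _ hx => hF (le_max_left n i) i hx.1

lemma coneExact_beilinsonTrunc_ofLE (n i : ℤ) (h : n ≤ i) :
    ConeExact (Subcomplex.ofLE (antitone_beilinsonTrunc hF (by lia : n ≤ n + 1))) i := by
  refine Subcomplex.coneExact_ofLE _ i (fun x hx _ => ⟨0, zero_mem _, ?_⟩)
  rw [map_zero, sub_zero]
  rw [mem_beilinsonTrunc_iff] at hx ⊢
  rwa [show max (n + 1) (i + 1) = max n (i + 1) by lia,
    show max (n + 1) (i + 1 + 1) = max n (i + 1 + 1) by lia]

lemma coneExact_ofLE_beilinsonTrunc_le (n i : ℤ) (h : i + 1 ≤ n) :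
    ConeExact (Subcomplex.ofLE (beilinsonTrunc_le hF n)) i := by
  refine Subcomplex.coneExact_ofLE _ i (fun x hx hdx => ⟨0, zero_mem _, ?_⟩)
  rw [map_zero, sub_zero]
  rw [mem_beilinsonTrunc_iff] at hdx ⊢
  refine ⟨by rwa [max_eq_left h], fun j => ?_⟩
  by_cases hj : i + 1 + 1 = j
  · subst hj
    exact hdx.1
  · rw [A.shape _ _ hj]
    exact zero_mem _

/-- The inclusion of the connective cover, as a natural transformation. -/
noncomputable def beilinsonTruncι :
    Subcomplex.functor (antitone_beilinsonTrunc hF) ⟶ Subcomplex.functor hF where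
  app n := Subcomplex.ofLE (beilinsonTrunc_le hF n.unop)

end Truncation

section

variable {k : Type u} [CommRing k] [HasDerivedCategory.{w} (ModuleCat.{v} k)]

lemma distinguished_of_iso₂ {B : DerivedCategory (ModuleCat.{v} k)}
    (T : Triangle (DerivedCategory (ModuleCat.{v} k))) (hT : T ∈ distTriang _) (e : T.obj₂ ≅ B) :
    Triangle.mk (T.mor₁ ≫ e.hom) (e.inv ≫ T.mor₂) T.mor₃ ∈
      distTriang (DerivedCategory (ModuleCat.{v} k)) :=
  isomorphic_distinguished _ hT _
    (Triangle.isoMk _ _ (Iso.refl T.obj₁) e.symm (Iso.refl T.obj₃)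
      (show (T.mor₁ ≫ e.hom) ≫ e.inv = 𝟙 T.obj₁ ≫ T.mor₁ by simp)
      (show (e.inv ≫ T.mor₂) ≫ 𝟙 T.obj₃ = e.inv ≫ T.mor₂ by simp)
      (show T.mor₃ ≫ (𝟙 T.obj₁)⟦(1 : ℤ)⟧' = 𝟙 T.obj₃ ≫ T.mor₃ by simp))

lemma exists_beilinson_triangle (X : ℤᵒᵖ ⥤ DerivedCategory (ModuleCat.{v} k)) :
    ∃ (X' X'' : ℤᵒᵖ ⥤ DerivedCategory (ModuleCat.{v} k)) (f : X' ⟶ X) (g : X ⟶ X'')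
      (h : X'' ⟶ X' ⋙ shiftFunctor (DerivedCategory (ModuleCat.{v} k)) (1 : ℤ)),
      BConnective k X' ∧
      (∀ n i : ℤ, -n - 1 < i → IsZero (Hh k i (X''.obj (op n)))) ∧
      ∀ n : ℤ, (Triangle.mk (f.app (op n)) (g.app (op n)) (h.app (op n)) ∈
        distTriang (DerivedCategory (ModuleCat.{v} k))) := by
  obtain ⟨A, F, hF, ⟨e⟩⟩ := exists_strictification X
  let T := triangleFunctor (beilinsonTruncι hF) ⋙ Q.mapTriangle
  let e' : T ⋙ Triangle.π₂ ≅ X := e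
  refine ⟨T ⋙ Triangle.π₁, T ⋙ Triangle.π₃, Functor.whiskerLeft T Triangle.π₁Toπ₂ ≫ e'.hom,
    e'.inv ≫ Functor.whiskerLeft T Triangle.π₂Toπ₃, Functor.whiskerLeft T Triangle.π₃Toπ₁,
    ?_, ?_, fun n => ?_⟩
  · rintro n G ⟨g, h, hT⟩ i hi
    obtain ⟨j, hj⟩ : ∃ j, -i = j + 1 := ⟨-i - 1, by lia⟩
    rw [Hh, hj]
    exact isZero_homology_obj₃
      (Subcomplex.ofLE (antitone_beilinsonTrunc hF (by lia : n ≤ n + 1))) _ hT (Iso.refl _) j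
      (coneExact_beilinsonTrunc_ofLE hF n j (by lia))
  · intro n i hi
    obtain ⟨j, hj⟩ : ∃ j, -i = j + 1 := ⟨-i - 1, by lia⟩
    rw [Hh, hj]
    exact (isZero_homology_Q_obj_iff _ _).2 ((exactAt_mappingCone_iff _ j).2
      (coneExact_ofLE_beilinsonTrunc_le hF n j (by lia)))
  · exact distinguished_of_iso₂ _
      (coneTriangle_distinguished (Subcomplex.ofLE (beilinsonTrunc_le hF n))) (e'.app (op n))

end

section ProductComplex

variable (K : ℕ → CochainComplex (ModuleCat.{v} R) ℤ)

/-- The product of a sequence of complexes of modules. -/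
noncomputable def prodComplex : CochainComplex (ModuleCat.{v} R) ℤ where
  X i := ModuleCat.of R (∀ m, (K m).X i)
  d i j := ModuleCat.ofHom (LinearMap.pi fun m => ((K m).d i j).hom ∘ₗ LinearMap.proj m)
  shape i j h := by
    ext x m
    exact ConcreteCategory.congr_hom ((K m).shape i j h) (x m)
  d_comp_d' i j k _ _ := by
    ext x m
    exact ConcreteCategory.congr_hom ((K m).d_comp_d i j k) (x m)

/-- The projections from the product of a sequence of complexes. -/
noncomputable def prodπ (m : ℕ) : prodComplex K ⟶ K m where
  f _ := ModuleCat.ofHom (LinearMap.proj m)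
  comm' _ _ _ := rfl

variable {K} {A : CochainComplex (ModuleCat.{v} R) ℤ}

/-- Constructor for morphisms to a product of complexes. -/
noncomputable def prodLift (f : ∀ m, A ⟶ K m) : A ⟶ prodComplex K where
  f i := ModuleCat.ofHom (LinearMap.pi fun m => ((f m).f i).hom)
  comm' i j _ := by
    ext x
    funext m
    exact ConcreteCategory.congr_hom ((f m).comm i j) x

lemma prodLift_prodπ (f : ∀ m, A ⟶ K m) (m : ℕ) : prodLift f ≫ prodπ K m = f m := rfl

/-- The product of a sequence of morphisms of complexes. -/
noncomputable def prodMap {L : ℕ → CochainComplex (ModuleCat.{v} R) ℤ} (s : ∀ m, K m ⟶ L m) :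
    prodComplex K ⟶ prodComplex L :=
  prodLift fun m => prodπ K m ≫ s m

lemma coneExact_prodMap {L : ℕ → CochainComplex (ModuleCat.{v} R) ℤ} (s : ∀ m, K m ⟶ L m) (i : ℤ)
    (hs : ∀ m, ConeExact (s m) i) : ConeExact (prodMap s) i := by
  intro x z hz hx
  choose v u hv hu using fun m => hs m (x m) (z m) (congrFun hz m) (congrFun hx m)
  exact ⟨v, u, funext hv, funext hu⟩

/-- A sequence of homotopies induces a homotopy for the morphisms to the product. -/
noncomputable def prodLiftHomotopy (f g : ∀ m, A ⟶ K m) (h : ∀ m, Homotopy (f m) (g m)) :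
    Homotopy (prodLift f) (prodLift g) :=
  homotopyMk _ _ (fun i => ModuleCat.ofHom (LinearMap.pi fun m => ((h m).hom (i + 1) i).hom))
    (fun i => by
      ext x
      funext m
      have := (h m).comm (i + 1)
      rw [dNext_eq _ (show (ComplexShape.up ℤ).Rel (i + 1) (i + 1 + 1) from rfl),
        prevD_eq _ (show (ComplexShape.up ℤ).Rel i (i + 1) from rfl)] at this
      exact ConcreteCategory.congr_hom this x)

/-- The family defined by `a m` for `N ≤ m`, and by descending recursion for `m < N`. -/
def descendingRec {T : ℕ → Type*} (step : ∀ m, T (m + 1) → T m) (N : ℕ) (a : ∀ m, T m) (m : ℕ) :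
    T m :=
  if N ≤ m then a m else step m (descendingRec step N a (m + 1))
termination_by N - m

/-- The difference between the identity and the shift of the product of a tower. -/
noncomputable def towerDiff (t : ∀ m, K (m + 1) ⟶ K m) : prodComplex K ⟶ prodComplex K :=
  𝟙 _ - prodLift fun m => prodπ K (m + 1) ≫ t m

lemma coneExact_towerDiff (t : ∀ m, K (m + 1) ⟶ K m)
    (h : ∀ i, ∃ N, ∀ m, N ≤ m → (K m).ExactAt i) (i : ℤ) :
    ConeExact (towerDiff t) i := by
  intro x z hz hx
  have hz' (m : ℕ) : (K m).d (i + 1 + 1) (i + 1 + 1 + 1) (z m) = 0 := congrFun hz m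
  have hx' (m : ℕ) : z m - (t m).f (i + 1 + 1) (z (m + 1)) =
      (K m).d (i + 1) (i + 1 + 1) (x m) := congrFun hx m
  obtain ⟨N₁, h₁⟩ := h (i + 1)
  obtain ⟨N₂, h₂⟩ := h (i + 1 + 1)
  let N := max N₁ N₂
  have ha (m : ℕ) : ∃ a : (K m).X (i + 1), N ≤ m → (K m).d (i + 1) (i + 1 + 1) a = z m := by
    by_cases hm : N ≤ m
    · obtain ⟨a, ha⟩ := (exactAt_succ_iff _ _).1 (h₂ m (by lia)) (z m) (hz' m)
      exact ⟨a, fun _ => ha⟩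
    · exact ⟨0, by lia⟩
  choose a ha using ha
  let step (m : ℕ) (y : (K (m + 1)).X (i + 1)) : (K m).X (i + 1) := x m + (t m).f (i + 1) y
  let w : ∀ m, (K m).X (i + 1) := descendingRec step N a
  have hw₁ (m : ℕ) (hm : N ≤ m) : w m = a m := by
    simp only [w]
    rw [descendingRec, if_pos hm]
  have hw₂ (m : ℕ) (hm : m < N) : w m = x m + (t m).f (i + 1) (w (m + 1)) := by
    simp only [w]
    rw [descendingRec, if_neg (by lia)]
  have hcomm (m : ℕ) (y : (K (m + 1)).X (i + 1)) : (K m).d (i + 1) (i + 1 + 1)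
      ((t m).f (i + 1) y) = (t m).f (i + 1 + 1) ((K (m + 1)).d (i + 1) (i + 1 + 1) y) :=
    ConcreteCategory.congr_hom ((t m).comm (i + 1) (i + 1 + 1)) y
  have hdw (m r : ℕ) (hr : N ≤ m + r) : (K m).d (i + 1) (i + 1 + 1) (w m) = z m := by
    induction r generalizing m with
    | zero => rw [hw₁ m (by lia), ha m (by lia)]
    | succ r hr' =>
      by_cases hm : N ≤ m
      · rw [hw₁ m hm, ha m hm]
      · rw [hw₂ m (by lia), map_add, hcomm, hr' (m + 1) (by lia), ← hx', sub_add_cancel]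
  have hu (m : ℕ) : ∃ u : (K m).X i, x m =
      w m - (t m).f (i + 1) (w (m + 1)) + (K m).d i (i + 1) u := by
    by_cases hm : N ≤ m
    · obtain ⟨u, hu⟩ := (exactAt_succ_iff _ _).1 (h₁ m (by lia))
        (x m - (w m - (t m).f (i + 1) (w (m + 1)))) (by
          rw [map_sub, map_sub, hcomm, hdw m N (by lia), hdw (m + 1) N (by lia), hx', sub_self])
      exact ⟨u, by rw [hu]; abel⟩
    · exact ⟨0, by rw [hw₂ m (by lia), map_zero]; abel⟩
  choose u hu using hu
  exact ⟨w, u, funext fun m => hdw m N (by lia), funext hu⟩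

end ProductComplex

section Tower

variable [HasDerivedCategory.{w} (ModuleCat.{v} R)] {A : CochainComplex (ModuleCat.{v} R) ℤ}

lemma exists_homotopy_of_Q_map_eq_zero {K : CochainComplex (ModuleCat.{v} R) ℤ} (f : A ⟶ K)
    (hf : Q.map f = 0) :
    ∃ (L : CochainComplex (ModuleCat.{v} R) ℤ) (u : K ⟶ L), IsIso (Q.map u) ∧
      Nonempty (Homotopy (f ≫ u) 0) := by
  have h : Qh.map ((HomotopyCategory.quotient _ _).map f) =
      Qh.map ((HomotopyCategory.quotient _ _).map (0 : A ⟶ K)) := by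
    change Q.map f = Q.map 0
    rw [hf, Functor.map_zero]
  rw [MorphismProperty.map_eq_iff_postcomp Qh (HomotopyCategory.quasiIso (ModuleCat.{v} R) _)] at h
  obtain ⟨L, u, hu, h⟩ := h
  obtain ⟨L, rfl⟩ := HomotopyCategory.quotient_obj_surjective L
  obtain ⟨u, rfl⟩ := (HomotopyCategory.quotient _ _).map_surjective u
  rw [← isIso_Qh_map_iff] at hu
  refine ⟨L, u, hu, ⟨HomotopyCategory.homotopyOfEq _ _ ?_⟩⟩
  rw [Functor.map_comp, h, ← Functor.map_comp, zero_comp]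

variable {K : ℕ → CochainComplex (ModuleCat.{v} R) ℤ}

lemma isIso_Q_map_prodMap {L : ℕ → CochainComplex (ModuleCat.{v} R) ℤ} (s : ∀ m, K m ⟶ L m)
    (hs : ∀ m, IsIso (Q.map (s m))) : IsIso (Q.map (prodMap s)) :=
  (isIso_Q_map_iff _).2 fun i => coneExact_prodMap s i fun m => (isIso_Q_map_iff _).1 (hs m) i

lemma exists_hom_Q_obj_prodComplex (b : ∀ m, Q.obj A ⟶ Q.obj (K m)) :
    ∃ φ : Q.obj A ⟶ Q.obj (prodComplex K), ∀ m, φ ≫ Q.map (prodπ K m) = b m := by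
  choose L g s hs hb using fun m => left_fac (b m)
  have := isIso_Q_map_prodMap s hs
  refine ⟨Q.map (prodLift g) ≫ inv (Q.map (prodMap s)), fun m => ?_⟩
  have h : Q.map (prodMap s) ≫ Q.map (prodπ L m) = Q.map (prodπ K m) ≫ Q.map (s m) := by
    rw [← Functor.map_comp, ← Functor.map_comp]
    rfl
  rw [hb, ← cancel_mono (Q.map (s m)), Category.assoc, Category.assoc, ← h,
    IsIso.inv_hom_id_assoc, ← Functor.map_comp, prodLift_prodπ, Category.assoc, IsIso.inv_hom_id,
    Category.comp_id]

lemma Q_obj_prodComplex_hom_eq_zero (φ : Q.obj A ⟶ Q.obj (prodComplex K))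
    (hφ : ∀ m, φ ≫ Q.map (prodπ K m) = 0) : φ = 0 := by
  obtain ⟨A', s, hs, f, rfl⟩ := right_fac φ
  choose L u hu h using fun m => exists_homotopy_of_Q_map_eq_zero (f ≫ prodπ K m) (by
    have := hφ m
    rwa [Category.assoc, ← cancel_epi (Q.map s), IsIso.hom_inv_id_assoc, comp_zero,
      ← Functor.map_comp] at this)
  have := isIso_Q_map_prodMap u hu
  have hf : f ≫ prodMap u = prodLift fun m => (f ≫ prodπ K m) ≫ u m := rfl
  have h0 : (0 : A' ⟶ prodComplex L) = prodLift fun m => 0 := rfl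
  have h1 : Q.map (f ≫ prodMap u) = 0 := by
    rw [hf, Q_map_eq_of_homotopy _ (prodLiftHomotopy _ _ fun m => (h m).some), ← h0,
      Functor.map_zero]
  rw [Functor.map_comp] at h1
  rw [← cancel_mono (Q.map (prodMap u)), Category.assoc, h1, comp_zero, zero_comp]

/-- A compatible family of morphisms to a tower whose terms are more and more acyclic vanishes. -/
lemma tower_hom_eq_zero (t : ∀ m, K (m + 1) ⟶ K m)
    (h : ∀ i, ∃ N, ∀ m, N ≤ m → (K m).ExactAt i) (b : ∀ m, Q.obj A ⟶ Q.obj (K m))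
    (hb : ∀ m, b (m + 1) ≫ Q.map (t m) = b m) (m : ℕ) : b m = 0 := by
  obtain ⟨φ, hφ⟩ := exists_hom_Q_obj_prodComplex b
  have : IsIso (Q.map (towerDiff t)) := (isIso_Q_map_iff _).2 (coneExact_towerDiff t h)
  have h1 : φ ≫ Q.map (towerDiff t) = 0 := by
    refine Q_obj_prodComplex_hom_eq_zero _ (fun m => ?_)
    have h2 : towerDiff t ≫ prodπ K m = prodπ K m - prodπ K (m + 1) ≫ t m := rfl
    rw [Category.assoc, ← Functor.map_comp, h2, Functor.map_sub, Functor.map_comp,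
      Preadditive.comp_sub, ← Category.assoc, hφ, hφ, hb, sub_self]
  have h3 : φ = 0 := (cancel_mono (Q.map (towerDiff t))).1 (by rw [h1, zero_comp])
  rw [← hφ, h3, zero_comp]

end Tower

section Orthogonality

open TStructure

variable {k : Type u} [CommRing k] [HasDerivedCategory.{w} (ModuleCat.{v} k)]

lemma isLE_of_isZero_Hh {G : DerivedCategory (ModuleCat.{v} k)} {n : ℤ}
    (h : ∀ i : ℤ, i < -n → IsZero (Hh k i G)) : t.IsLE G n :=
  (isLE_iff G n).2 fun i hi => by simpa only [Hh, neg_neg] using h (-i) (by lia)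

lemma isGE_of_isZero_Hh {G : DerivedCategory (ModuleCat.{v} k)} {n : ℤ}
    (h : ∀ i : ℤ, -n < i → IsZero (Hh k i G)) : t.IsGE G n :=
  (isGE_iff G n).2 fun i hi => by simpa only [Hh, neg_neg] using h (-i) (by lia)

lemma isZero_Hh_of_isLE {G : DerivedCategory (ModuleCat.{v} k)} {n : ℤ} (hG : t.IsLE G n)
    (i : ℤ) (hi : i < -n) : IsZero (Hh k i G) :=
  (isLE_iff G n).1 hG (-i) (by lia)

lemma isZero_Hh_of_isGE {G : DerivedCategory (ModuleCat.{v} k)} {n : ℤ} (hG : t.IsGE G n)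
    (i : ℤ) (hi : -n < i) : IsZero (Hh k i G) :=
  (isGE_iff G n).1 hG (-i) (by lia)

lemma eq_zero_of_mor₁_comp_eq_zero {T : Triangle (DerivedCategory (ModuleCat.{v} k))}
    (hT : T ∈ distTriang _) {W : DerivedCategory (ModuleCat.{v} k)} {n m : ℤ} (h : n < m)
    (h₃ : t.IsLE T.obj₃ n) (hW : t.IsGE W m) (f : T.obj₂ ⟶ W) (hf : T.mor₁ ≫ f = 0) : f = 0 := by
  obtain ⟨g, rfl⟩ := T.yoneda_exact₂ hT f hf
  rw [t.zero g n m h, comp_zero]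

lemma exists_mor₁_comp_eq {T : Triangle (DerivedCategory (ModuleCat.{v} k))}
    (hT : T ∈ distTriang _) {W : DerivedCategory (ModuleCat.{v} k)} {n m : ℤ} (h : n + 1 < m)
    (h₃ : t.IsLE T.obj₃ n) (hW : t.IsGE W m) (f : T.obj₁ ⟶ W) :
    ∃ g : T.obj₂ ⟶ W, T.mor₁ ≫ g = f := by
  have : t.IsLE T.invRotate.obj₁ (n + 1) := t.isLE_shift T.obj₃ n (-1) (n + 1)
  obtain ⟨g, hg⟩ := T.invRotate.yoneda_exact₂ (inv_rot_of_distTriang _ hT) f (t.zero _ (n + 1) m h)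
  exact ⟨g, hg.symm⟩

variable {X : ℤᵒᵖ ⥤ DerivedCategory (ModuleCat.{v} k)}

lemma exists_gradedPiece_triangle (hX : BConnective k X) (n : ℤ) :
    ∃ (G : DerivedCategory (ModuleCat.{v} k)) (g : X.obj (op n) ⟶ G)
      (h : G ⟶ (X.obj (op (n + 1)))⟦(1 : ℤ)⟧),
      Triangle.mk (X.map (homOfLE (by lia : n ≤ n + 1)).op) g h ∈ distTriang _ ∧ t.IsLE G n := by
  obtain ⟨G, g, h, hT⟩ := distinguished_cocone_triangle (X.map (homOfLE (by lia : n ≤ n + 1)).op)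
  exact ⟨G, g, h, hT, isLE_of_isZero_Hh (hX n G ⟨g, h, hT⟩)⟩

lemma map_homOfLE_op_succ (n p : ℤ) (h : n ≤ p) :
    X.map (homOfLE (by lia : n ≤ p + 1)).op =
      X.map (homOfLE (by lia : p ≤ p + 1)).op ≫ X.map (homOfLE h).op := by
  rw [← X.map_comp]
  rfl

lemma eq_zero_of_map_comp_eq_zero (hX : BConnective k X)
    {W : DerivedCategory (ModuleCat.{v} k)} {m : ℤ} (hW : t.IsGE W m) (n p : ℤ) (h : n ≤ p)
    (hp : p ≤ m) (f : X.obj (op n) ⟶ W) (hf : X.map (homOfLE h).op ≫ f = 0) : f = 0 := by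
  induction p, h using Int.leInduction with
  | base => simpa using hf
  | succ p h hrec =>
    obtain ⟨G, g, δ, hT, hG⟩ := exists_gradedPiece_triangle hX p
    refine hrec (by lia) (eq_zero_of_mor₁_comp_eq_zero hT (by lia) hG hW _ ?_)
    rwa [map_homOfLE_op_succ n p h, Category.assoc] at hf

lemma exists_map_comp_eq (hX : BConnective k X)
    {W : DerivedCategory (ModuleCat.{v} k)} {m : ℤ} (hW : t.IsGE W m) (n p : ℤ) (h : n ≤ p)
    (hp : p < m) (f : X.obj (op p) ⟶ W) :
    ∃ g : X.obj (op n) ⟶ W, X.map (homOfLE h).op ≫ g = f := by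
  induction p, h using Int.leInduction with
  | base => exact ⟨f, by simp⟩
  | succ p h hrec =>
    obtain ⟨G, g, δ, hT, hG⟩ := exists_gradedPiece_triangle hX p
    obtain ⟨f₁, hf₁⟩ := exists_mor₁_comp_eq hT (by lia) hG hW f
    obtain ⟨f₂, hf₂⟩ := hrec (by lia) f₁
    exact ⟨f₂, by rw [map_homOfLE_op_succ n p h, Category.assoc, hf₂]; exact hf₁⟩

/-- Morphisms from the connective part of the Beilinson t-structure to its strictly coconnective
part vanish. -/
lemma hom_eq_zero (hX : BConnective k X)
    {Z : ℤᵒᵖ ⥤ DerivedCategory (ModuleCat.{v} k)} (hZ : ∀ n : ℤ, t.IsGE (Z.obj (op n)) (n + 1))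
    (η : X ⟶ Z) : η = 0 := by
  ext ⟨n⟩
  choose b hb using fun m : ℕ => exists_map_comp_eq hX (hZ (n + m)) n (n + m) (by lia) (by lia)
    (η.app (op (n + m)))
  have hb' (m : ℕ) : b (m + 1) ≫
      Z.map (homOfLE (by lia : n + (m : ℤ) ≤ n + ((m + 1 : ℕ) : ℤ))).op = b m := by
    rw [← sub_eq_zero]
    refine eq_zero_of_map_comp_eq_zero hX (hZ (n + m)) n (n + ((m + 1 : ℕ) : ℤ)) (by lia) (by lia)
      _ ?_
    rw [Preadditive.comp_sub, sub_eq_zero, ← Category.assoc, hb, ← η.naturality, ← hb,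
      ← Category.assoc, ← X.map_comp]
    rfl
  obtain ⟨A, F, hF, ⟨e⟩⟩ := exists_strictification Z
  let ε : Q.obj (Q.objPreimage (X.obj (op n))) ≅ X.obj (op n) := Q.objObjPreimageIso _
  have h0 := tower_hom_eq_zero (K := fun m : ℕ => (F (n + m)).toComplex)
    (fun m => Subcomplex.ofLE (hF (by lia : n + (m : ℤ) ≤ n + ((m + 1 : ℕ) : ℤ))))
    (fun i => ⟨(i - n).toNat, fun m hm => by
      have : IsGE (Q.obj (F (n + m)).toComplex) (n + m + 1) :=
        have := hZ (n + m)
        t.isGE_of_iso (e.symm.app (op (n + m))) _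
      rw [isGE_Q_obj_iff] at this
      exact (F (n + m)).toComplex.exactAt_of_isGE (n + m + 1) i (by lia)⟩)
    (fun m => ε.hom ≫ b m ≫ e.inv.app (op (n + m)))
    (fun m => by
      have := e.inv.naturality
        (homOfLE (by lia : n + (m : ℤ) ≤ n + ((m + 1 : ℕ) : ℤ))).op
      change (ε.hom ≫ b (m + 1) ≫ e.inv.app (op (n + ((m + 1 : ℕ) : ℤ)))) ≫
        (Subcomplex.functor hF ⋙ Q).map
          (homOfLE (by lia : n + (m : ℤ) ≤ n + ((m + 1 : ℕ) : ℤ))).op =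
        ε.hom ≫ b m ≫ (show Z.obj _ ⟶ (Subcomplex.functor hF ⋙ Q).obj _ from
          e.inv.app (op (n + (m : ℤ))))
      rw [Category.assoc, Category.assoc, ← this, ← hb' m, Category.assoc]) 0
  have hb0 : b 0 = 0 := by
    rw [← cancel_mono (e.inv.app (op (n + (0 : ℕ)))), ← cancel_epi ε.hom, zero_comp, comp_zero]
    exact h0
  have h1 : η.app (op (n + (0 : ℕ))) = 0 := by rw [← hb, hb0, comp_zero]
  rwa [Nat.cast_zero, add_zero] at h1

end Orthogonality

section Shift

open TStructure

variable {k : Type u} [CommRing k] [HasDerivedCategory.{w} (ModuleCat.{v} k)]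

lemma bConnective_shift {X : ℤᵒᵖ ⥤ DerivedCategory (ModuleCat.{v} k)} (hX : BConnective k X) :
    BConnective k (X ⋙ shiftFunctor (DerivedCategory (ModuleCat.{v} k)) (1 : ℤ)) := by
  rintro n G ⟨g, h, hT⟩
  obtain ⟨G', g', h', hT', hG'⟩ := exists_gradedPiece_triangle hX n
  have e := isoTriangleOfIso₁₂ _ _ (Triangle.shift_distinguished _ hT' 1) hT
    (-Iso.refl _) (Iso.refl _) (by
      change ((1 : ℤ).negOnePow • (X.map _)⟦(1 : ℤ)⟧') ≫ 𝟙 _ = (-𝟙 _) ≫ (X.map _)⟦(1 : ℤ)⟧'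
      rw [Int.negOnePow_one, Category.comp_id, Preadditive.neg_comp, Category.id_comp,
        Units.neg_smul, one_smul])
  have : t.IsLE (G'⟦(1 : ℤ)⟧) (n - 1) := t.isLE_shift G' n 1 (n - 1)
  have : t.IsLE G (n - 1) :=
    t.isLE_of_iso (show G'⟦(1 : ℤ)⟧ ≅ G from Triangle.π₃.mapIso e) (n - 1)
  exact isZero_Hh_of_isLE (t.isLE_of_le G (n - 1) n)

lemma isGE_shift {Y : ℤᵒᵖ ⥤ DerivedCategory (ModuleCat.{v} k)}
    (hY : BCoconnective k Y) (n : ℤ) :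
    t.IsGE ((Y.obj (op n))⟦(-1 : ℤ)⟧) (n + 1) :=
  have := isGE_of_isZero_Hh (hY n)
  t.isGE_shift (Y.obj (op n)) n (-1) (n + 1)

lemma bCoconnective_shift {Y : ℤᵒᵖ ⥤ DerivedCategory (ModuleCat.{v} k)} (hY : BCoconnective k Y) :
    BCoconnective k (Y ⋙ shiftFunctor (DerivedCategory (ModuleCat.{v} k)) (-1 : ℤ)) := fun n =>
  have := isGE_shift hY n
  isZero_Hh_of_isGE (t.isGE_of_ge ((Y.obj (op n))⟦(-1 : ℤ)⟧) n (n + 1))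

end Shift

end BeilinsonTStructure

/-- the pair `(DF(k)_{≥0}, DF(k)_{≤0})` satisfies the axioms of a
t-structure on the filtered derived category `DF(k) = Fun(ℤᵒᵖ, D(k))` (the Beilinson
t-structure): (i) maps from connectives to shifted coconnectives vanish; (ii) stability
under the appropriate shifts (`⟦1⟧` is the homological shift `[1]`); (iii) every `X`
fits in a (componentwise) fiber sequence `X' → X → X''` with `X'` connective and
`X''` a shift `[-1]` of a coconnective, i.e. `X''(n) ∈ D(k)_{≤ -n-1}` for all `n`. -/
theorem stmt10 :
    (∀ (X Y : ℤᵒᵖ ⥤ DerivedCategory (ModuleCat k)), BConnective k X → BCoconnective k Y →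
      ∀ η : X ⟶ Y ⋙ shiftFunctor (DerivedCategory (ModuleCat k)) (-1 : ℤ), η = 0) ∧
    (∀ X : ℤᵒᵖ ⥤ DerivedCategory (ModuleCat k), BConnective k X →
      BConnective k (X ⋙ shiftFunctor (DerivedCategory (ModuleCat k)) (1 : ℤ))) ∧
    (∀ Y : ℤᵒᵖ ⥤ DerivedCategory (ModuleCat k), BCoconnective k Y →
      BCoconnective k (Y ⋙ shiftFunctor (DerivedCategory (ModuleCat k)) (-1 : ℤ))) ∧
    (∀ X : ℤᵒᵖ ⥤ DerivedCategory (ModuleCat k),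
      ∃ (X' X'' : ℤᵒᵖ ⥤ DerivedCategory (ModuleCat k)) (f : X' ⟶ X) (g : X ⟶ X'')
        (h : X'' ⟶ X' ⋙ shiftFunctor (DerivedCategory (ModuleCat k)) (1 : ℤ)),
        BConnective k X' ∧
        (∀ n i : ℤ, -n - 1 < i → IsZero (Hh k i (X''.obj (op n)))) ∧
        ∀ n : ℤ, (Triangle.mk (f.app (op n)) (g.app (op n)) (h.app (op n)) ∈
          distTriang (DerivedCategory (ModuleCat k)))) := by
  refine ⟨fun X Y hX hY => BeilinsonTStructure.hom_eq_zero hX (BeilinsonTStructure.isGE_shift hY),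
    fun X hX => BeilinsonTStructure.bConnective_shift hX,
    fun Y hY => BeilinsonTStructure.bCoconnective_shift hY,
    BeilinsonTStructure.exists_beilinson_triangle⟩
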